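/- arXiv:2002.06558 — 2 statements merged into one kernel-verified Lean document; each statement's English description precedes it below -/
import Mathlib

section
/- Let n be a positive integer and let W₁, W₂ be two non-empty closed spherically convex subsets of the unit sphere Sⁿ ⊆ ℝ^{n+1} with W₁ ∩ W₂ = ∅. Then there exists a point P ∈ Sⁿ such that P·Q > 0 for every Q ∈ W₁ and P·R < 0 for every R ∈ W₂. -/
open scoped RealInnerProductSpace

/-- A subset `W` of the unit sphere `Sⁿ ⊆ ℝ^{n+1}` is spherically convex if it is
hemispherical (there is `P ∈ Sⁿ` with `P·Q > 0` for all `Q ∈ W`) and for any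
`P, Q ∈ W` and `t ∈ [0,1]` the unit vector `(tP + (1-t)Q)/‖tP + (1-t)Q‖` lies in `W`. -/
def SphericallyConvex {n : ℕ} (W : Set (EuclideanSpace ℝ (Fin (n + 1)))) : Prop :=
  (∃ P ∈ Metric.sphere (0 : EuclideanSpace ℝ (Fin (n + 1))) 1, ∀ Q ∈ W, 0 < ⟪P, Q⟫) ∧
    ∀ P ∈ W, ∀ Q ∈ W, ∀ t ∈ Set.Icc (0 : ℝ) 1,
      ‖t • P + (1 - t) • Q‖⁻¹ • (t • P + (1 - t) • Q) ∈ W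

/-- The open cone over a spherically convex set is convex. -/
theorem SphericallyConvex.convex_setOf_normalize_mem {n : ℕ}
    {W : Set (EuclideanSpace ℝ (Fin (n + 1)))}
    (hsub : W ⊆ Metric.sphere 0 1) (hW : SphericallyConvex W) :
    Convex ℝ {x | ‖x‖⁻¹ • x ∈ W} := by
  intro x hx y hy a b ha hb hab
  simp only [Set.mem_ofPred_eq] at hx hy ⊢
  have norm_pos_of_mem : ∀ z : EuclideanSpace ℝ (Fin (n + 1)), ‖z‖⁻¹ • z ∈ W → 0 < ‖z‖ := by
    intro z hz
    refine norm_pos_iff.2 fun h => ?_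
    have := hsub hz
    simp [h] at this
  have hx0 := norm_pos_of_mem x hx
  have hy0 := norm_pos_of_mem y hy
  set s := a * ‖x‖ + b * ‖y‖ with hs
  have hs0 : 0 < s := by
    rcases ha.eq_or_lt with rfl | ha'
    · have : b = 1 := by linarith
      simp [hs, this, hy0]
    · positivity
  have key := hW.2 _ hx _ hy (a * ‖x‖ / s)
    ⟨by positivity, by rw [div_le_one hs0, hs]; nlinarith [mul_nonneg hb hy0.le]⟩
  have hcomb : (a * ‖x‖ / s) • (‖x‖⁻¹ • x) + (1 - a * ‖x‖ / s) • (‖y‖⁻¹ • y)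
      = s⁻¹ • (a • x + b • y) := by
    have h1 : 1 - a * ‖x‖ / s = b * ‖y‖ / s := by
      field_simp
      rw [hs]
      ring
    rw [h1, smul_smul, smul_smul, smul_add, smul_smul, smul_smul]
    congr 2 <;> field_simp
  rw [hcomb, norm_smul, smul_smul, norm_inv, Real.norm_of_nonneg hs0.le] at key
  convert key using 2
  field_simp

/-- Closedness relative to the sphere gives compactness in the ambient space. -/
theorem isCompact_of_isClosed_preimage_sphere {n : ℕ}
    {W : Set (EuclideanSpace ℝ (Fin (n + 1)))} (hsub : W ⊆ Metric.sphere 0 1)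
    (hcl : IsClosed {x : Metric.sphere (0 : EuclideanSpace ℝ (Fin (n + 1))) 1 |
      (x : EuclideanSpace ℝ (Fin (n + 1))) ∈ W}) : IsCompact W := by
  have := hcl.isCompact.image continuous_subtype_val
  convert this using 1
  ext x
  constructor
  · exact fun hx => ⟨⟨x, hsub hx⟩, hx, rfl⟩
  · rintro ⟨y, hy, rfl⟩
    exact hy

/-- The convex join of two compact sets is compact. -/
theorem IsCompact.convexJoin {E : Type*} [AddCommGroup E] [Module ℝ E] [TopologicalSpace E]
    [ContinuousAdd E] [ContinuousSMul ℝ E] {s t : Set E} (hs : IsCompact s) (ht : IsCompact t) :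
    IsCompact (convexJoin ℝ s t) := by
  have hc : Continuous fun p : (E × E) × ℝ => (1 - p.2) • p.1.1 + p.2 • p.1.2 := by fun_prop
  convert ((hs.prod ht).prod (isCompact_Icc (a := (0 : ℝ)) (b := 1))).image hc using 1
  ext z
  simp only [mem_convexJoin, segment_eq_image, Set.mem_image, Set.mem_prod, Prod.exists]
  constructor
  · rintro ⟨x, hx, y, hy, r, hr, rfl⟩
    exact ⟨x, y, r, ⟨⟨hx, hy⟩, hr⟩, rfl⟩
  · rintro ⟨x, y, r, ⟨⟨hx, hy⟩, hr⟩, rfl⟩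
    exact ⟨x, hx, y, hy, r, hr, rfl⟩

/-- A compact spherically convex set is the radial projection of a compact convex set. -/
theorem SphericallyConvex.exists_isCompact_convex {n : ℕ}
    {W : Set (EuclideanSpace ℝ (Fin (n + 1)))}
    (hsub : W ⊆ Metric.sphere 0 1) (hW : SphericallyConvex W) (hcpt : IsCompact W) :
    ∃ S : Set (EuclideanSpace ℝ (Fin (n + 1))), IsCompact S ∧ Convex ℝ S ∧
      (∀ x ∈ S, ‖x‖⁻¹ • x ∈ W) ∧ ∀ x ∈ W, ∃ c : ℝ, 0 < c ∧ c • x ∈ S := by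
  obtain ⟨P, -, hP⟩ := hW.1
  refine ⟨{x | ‖x‖⁻¹ • x ∈ W} ∩ {x | ⟪P, x⟫ = 1}, ?_, ?_, fun x hx => hx.1, ?_⟩
  · have hcont : ContinuousOn (fun x => ⟪P, x⟫⁻¹ • x) W :=
      ContinuousOn.smul (ContinuousOn.inv₀ (by fun_prop) fun x hx => (hP x hx).ne') continuousOn_id
    convert hcpt.image_of_continuousOn hcont using 1
    ext x
    constructor
    · rintro ⟨hx, hx1⟩
      have hx0 : ‖x‖ ≠ 0 := fun h => by
        rw [Set.mem_ofPred_eq, norm_eq_zero.1 h, inner_zero_right] at hx1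
        exact zero_ne_one hx1
      refine ⟨_, hx, ?_⟩
      simp only [Set.mem_ofPred_eq] at hx1
      simp [real_inner_smul_right, hx1, smul_smul, hx0]
    · rintro ⟨y, hy, rfl⟩
      have hpos := hP y hy
      have hy1 : ‖y‖ = 1 := by simpa using hsub hy
      constructor
      · simpa [norm_smul, hy1, abs_of_pos hpos, smul_smul, hpos.ne'] using hy
      · simp [real_inner_smul_right, hpos.ne']
  · exact (hW.convex_setOf_normalize_mem hsub).inter
      (convex_hyperplane (innerSL ℝ P).isLinear 1)
  · intro x hx
    have hpos := hP x hx
    have hx1 : ‖x‖ = 1 := by simpa using hsub hx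
    refine ⟨⟪P, x⟫⁻¹, inv_pos.2 hpos, ?_, ?_⟩
    · simpa [norm_smul, hx1, abs_of_pos hpos, smul_smul, hpos.ne'] using hx
    · simp [real_inner_smul_right, hpos.ne']

theorem stmt_2 (n : ℕ) (hn : 0 < n)
    (W₁ W₂ : Set (EuclideanSpace ℝ (Fin (n + 1))))
    (hW₁sub : W₁ ⊆ Metric.sphere 0 1) (hW₂sub : W₂ ⊆ Metric.sphere 0 1)
    (hW₁ne : W₁.Nonempty) (hW₂ne : W₂.Nonempty)
    (hW₁cl : IsClosed {x : Metric.sphere (0 : EuclideanSpace ℝ (Fin (n + 1))) 1 |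
      (x : EuclideanSpace ℝ (Fin (n + 1))) ∈ W₁})
    (hW₂cl : IsClosed {x : Metric.sphere (0 : EuclideanSpace ℝ (Fin (n + 1))) 1 |
      (x : EuclideanSpace ℝ (Fin (n + 1))) ∈ W₂})
    (hW₁conv : SphericallyConvex W₁) (hW₂conv : SphericallyConvex W₂)
    (hdisj : W₁ ∩ W₂ = ∅) :
    ∃ P ∈ Metric.sphere (0 : EuclideanSpace ℝ (Fin (n + 1))) 1,
      (∀ Q ∈ W₁, 0 < ⟪P, Q⟫) ∧ (∀ R ∈ W₂, ⟪P, R⟫ < 0) := by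
  obtain ⟨S₁, hS₁cpt, hS₁conv, hS₁W, hWS₁⟩ := hW₁conv.exists_isCompact_convex hW₁sub
    (isCompact_of_isClosed_preimage_sphere hW₁sub hW₁cl)
  obtain ⟨S₂, hS₂cpt, hS₂conv, hS₂W, hWS₂⟩ := hW₂conv.exists_isCompact_convex hW₂sub
    (isCompact_of_isClosed_preimage_sphere hW₂sub hW₂cl)
  have hS₁ne : S₁.Nonempty := let ⟨x, hx⟩ := hW₁ne; let ⟨_, _, h⟩ := hWS₁ x hx; ⟨_, h⟩
  have hS₂ne : S₂.Nonempty := let ⟨x, hx⟩ := hW₂ne; let ⟨_, _, h⟩ := hWS₂ x hx; ⟨_, h⟩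
  have hne : ∀ {W : Set (EuclideanSpace ℝ (Fin (n + 1)))}, W ⊆ Metric.sphere 0 1 →
      ∀ x, ‖x‖⁻¹ • x ∈ W → x ≠ 0 := by
    rintro W hW x hx rfl
    have := hW hx
    simp at this
  have h0 : (0 : EuclideanSpace ℝ (Fin (n + 1))) ∉ convexJoin ℝ S₁ (-S₂) := by
    rw [mem_convexJoin]
    rintro ⟨x, hx, z, hz, a, b, ha, hb, hab, hxz⟩
    have hx' : ‖x‖⁻¹ • x ∈ W₁ := hS₁W x hx
    have hz' : ‖-z‖⁻¹ • -z ∈ W₂ := hS₂W _ hz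
    have hx0 := hne hW₁sub x hx'
    have hz0 : z ≠ 0 := neg_ne_zero.1 (hne hW₂sub _ hz')
    have ha0 : 0 < a := by
      refine ha.lt_of_ne' fun h => ?_
      have hb1 : b = 1 := by linarith
      simp [h, hb1, hz0] at hxz
    have hb0 : 0 < b := by
      refine hb.lt_of_ne' fun h => ?_
      have ha1 : a = 1 := by linarith
      simp [h, ha1, hx0] at hxz
    have hray : SameRay ℝ x (-z) := by
      refine Or.inr (Or.inr ⟨a, b, ha0, hb0, ?_⟩)
      rw [smul_neg]
      exact eq_neg_of_add_eq_zero_left hxz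
    rw [← (sameRay_iff_inv_norm_smul_eq_of_ne hx0 (neg_ne_zero.2 hz0)).1 hray] at hz'
    exact (Set.ext_iff.1 hdisj _).1 ⟨hx', hz'⟩
  obtain ⟨f, u, hu, hf⟩ :=
    geometric_hahn_banach_point_closed (hS₁conv.convexJoin hS₂conv.neg)
      (hS₁cpt.convexJoin hS₂cpt.neg).isClosed h0
  rw [map_zero] at hu
  set v := (InnerProductSpace.toDual ℝ (EuclideanSpace ℝ (Fin (n + 1)))).symm f
  have hv : ∀ x, ⟪v, x⟫ = f x := fun x => InnerProductSpace.toDual_symm_apply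
  have hpos₁ : ∀ x ∈ W₁, 0 < ⟪v, x⟫ := fun x hx => by
    obtain ⟨c, hc, hcx⟩ := hWS₁ x hx
    have := hu.trans (hf _ (subset_convexJoin_left hS₂ne.neg hcx))
    rw [← hv, real_inner_smul_right] at this
    exact pos_of_mul_pos_right this hc.le
  have hneg₂ : ∀ x ∈ W₂, ⟪v, x⟫ < 0 := fun x hx => by
    obtain ⟨c, hc, hcx⟩ := hWS₂ x hx
    have := hu.trans (hf _ (subset_convexJoin_right hS₁ne (Set.neg_mem_neg.2 hcx)))
    rw [← hv, inner_neg_right, real_inner_smul_right, neg_pos] at this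
    exact (pos_iff_neg_of_mul_neg this).1 hc
  have hv0 : 0 < ‖v‖ := by
    obtain ⟨x, hx⟩ := hW₁ne
    refine norm_pos_iff.2 fun h => ?_
    simpa [h] using hpos₁ x hx
  refine ⟨‖v‖⁻¹ • v, by simp [norm_smul, hv0.ne'], fun Q hQ => ?_, fun R hR => ?_⟩
  · rw [real_inner_smul_left]
    exact mul_pos (inv_pos.2 hv0) (hpos₁ Q hQ)
  · rw [real_inner_smul_left]
    exact mul_neg_of_pos_of_neg (inv_pos.2 hv0) (hneg₂ R hR)
end

section
/- Let n be a positive integer and let W₁, W₂ be two non-empty spherically convex subsets of the unit sphere Sⁿ ⊆ ℝ^{n+1} that are open in Sⁿ and satisfy W₁ ∩ W₂ = ∅. Then there exists a point P ∈ Sⁿ such that P·Q > 0 for every Q ∈ W₁ and P·R < 0 for every R ∈ W₂. -/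
open scoped RealInnerProductSpace

/-- The cone over a subset of the unit sphere that is closed under normalized convex combinations
is convex. -/
theorem convex_setOf_normalize_mem {E : Type*} [NormedAddCommGroup E] [NormedSpace ℝ E]
    {W : Set E} (hsub : W ⊆ Metric.sphere 0 1)
    (hW : ∀ P ∈ W, ∀ Q ∈ W, ∀ t ∈ Set.Icc (0 : ℝ) 1,
      ‖t • P + (1 - t) • Q‖⁻¹ • (t • P + (1 - t) • Q) ∈ W) :
    Convex ℝ {x : E | ‖x‖⁻¹ • x ∈ W} := by
  have norm_pos : ∀ x : E, ‖x‖⁻¹ • x ∈ W → 0 < ‖x‖ := by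
    intro x hx
    rw [norm_pos_iff]
    rintro rfl
    simpa using hsub hx
  intro x hx y hy a b ha hb hab
  have hx0 := norm_pos x hx
  have hy0 := norm_pos y hy
  have hs : 0 < a * ‖x‖ + b * ‖y‖ := by
    rcases ha.eq_or_lt with rfl | ha
    · have : b = 1 := by linarith
      simpa [this] using hy0
    · positivity
  set s := a * ‖x‖ + b * ‖y‖ with hs_def
  have ht : 1 - a * ‖x‖ / s = b * ‖y‖ / s := by
    field_simp
    rw [hs_def]
    ring
  have h := hW _ hx _ hy (a * ‖x‖ / s)
    ⟨by positivity, by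
      have : 0 ≤ b * ‖y‖ / s := by positivity
      linarith⟩
  have hz : (a * ‖x‖ / s) • ‖x‖⁻¹ • x + (1 - a * ‖x‖ / s) • ‖y‖⁻¹ • y
      = s⁻¹ • (a • x + b • y) := by
    rw [ht, smul_add, smul_smul, smul_smul, smul_smul, smul_smul]
    congr 2 <;> field_simp
  rw [hz, norm_smul, norm_inv, Real.norm_of_nonneg hs.le, smul_smul, mul_inv, inv_inv,
    mul_right_comm, mul_inv_cancel₀ hs.ne', one_mul] at h
  exact h

/-- The cone over a relatively open subset of the unit sphere is open. -/
theorem isOpen_setOf_normalize_mem {E : Type*} [NormedAddCommGroup E] [NormedSpace ℝ E]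
    {W : Set E} (hsub : W ⊆ Metric.sphere 0 1)
    (hW : IsOpen {x : Metric.sphere (0 : E) 1 | (x : E) ∈ W}) :
    IsOpen {x : E | ‖x‖⁻¹ • x ∈ W} := by
  obtain ⟨U, hU, hUW⟩ := isOpen_induced_iff.1 hW
  have hmem : ∀ x ∈ Metric.sphere (0 : E) 1, x ∈ U ↔ x ∈ W := fun x hx =>
    Set.ext_iff.1 hUW ⟨x, hx⟩
  have hcont : ContinuousOn (fun x : E => ‖x‖⁻¹ • x) {0}ᶜ :=
    (continuousOn_id.norm.inv₀ fun x hx => norm_ne_zero_iff.2 hx).smul continuousOn_id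
  convert hcont.isOpen_inter_preimage isOpen_compl_singleton hU using 1
  ext x
  rcases eq_or_ne x 0 with rfl | hx
  · simpa using fun h => by simpa using hsub h
  · have : ‖x‖⁻¹ • x ∈ Metric.sphere (0 : E) 1 := by
      simp [norm_smul, hx]
    simp [hx, hmem _ this]

/-- A constant bounded above by every positive multiple of a real number is nonpositive. -/
theorem nonpos_of_forall_pos_lt_mul {u c : ℝ} (h : ∀ t : ℝ, 0 < t → u < t * c) : u ≤ 0 := by
  by_contra! hu
  have hc : 0 < c := hu.trans (by simpa using h 1 one_pos)
  have := h (u / c) (by positivity)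
  rw [div_mul_cancel₀ _ hc.ne'] at this
  exact this.false

/-- Disjoint open convex nonempty sets stable under positive scaling are strictly separated by a
linear hyperplane. -/
theorem exists_dual_neg_pos_of_cones {E : Type*} [NormedAddCommGroup E] [NormedSpace ℝ E]
    {s t : Set E} (hs : Convex ℝ s) (hso : IsOpen s) (ht : Convex ℝ t) (hto : IsOpen t)
    (hsne : s.Nonempty) (htne : t.Nonempty)
    (hsc : ∀ x ∈ s, ∀ r : ℝ, 0 < r → r • x ∈ s) (htc : ∀ x ∈ t, ∀ r : ℝ, 0 < r → r • x ∈ t)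
    (hdisj : Disjoint s t) :
    ∃ f : StrongDual ℝ E, (∀ a ∈ s, f a < 0) ∧ ∀ b ∈ t, 0 < f b := by
  obtain ⟨f, u, hfs, hft⟩ := geometric_hahn_banach_open_open hs hso ht hto hdisj
  obtain ⟨a, ha⟩ := hsne
  obtain ⟨b, hb⟩ := htne
  have hu : u ≤ 0 := nonpos_of_forall_pos_lt_mul (c := f b) fun r hr => by
    simpa using hft _ (htc b hb r hr)
  have hu' : -u ≤ 0 := nonpos_of_forall_pos_lt_mul (c := -f a) fun r hr => by
    simpa using hfs _ (hsc a ha r hr)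
  exact ⟨f, fun x hx => (hfs x hx).trans_le hu, fun x hx => by linarith [hft x hx]⟩

theorem stmt_3 (n : ℕ) (hn : 0 < n)
    (W₁ W₂ : Set (EuclideanSpace ℝ (Fin (n + 1))))
    (hW₁sub : W₁ ⊆ Metric.sphere 0 1) (hW₂sub : W₂ ⊆ Metric.sphere 0 1)
    (hW₁ne : W₁.Nonempty) (hW₂ne : W₂.Nonempty)
    (hW₁op : IsOpen {x : Metric.sphere (0 : EuclideanSpace ℝ (Fin (n + 1))) 1 |
      (x : EuclideanSpace ℝ (Fin (n + 1))) ∈ W₁})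
    (hW₂op : IsOpen {x : Metric.sphere (0 : EuclideanSpace ℝ (Fin (n + 1))) 1 |
      (x : EuclideanSpace ℝ (Fin (n + 1))) ∈ W₂})
    (hW₁conv : SphericallyConvex W₁) (hW₂conv : SphericallyConvex W₂)
    (hdisj : W₁ ∩ W₂ = ∅) :
    ∃ P ∈ Metric.sphere (0 : EuclideanSpace ℝ (Fin (n + 1))) 1,
      (∀ Q ∈ W₁, 0 < ⟪P, Q⟫) ∧ (∀ R ∈ W₂, ⟪P, R⟫ < 0) := by
  have hunit : ∀ {W : Set (EuclideanSpace ℝ (Fin (n + 1)))}, W ⊆ Metric.sphere 0 1 →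
      ∀ x ∈ W, x ∈ {x | ‖x‖⁻¹ • x ∈ W} := by
    intro W hW x hx
    have : ‖x‖ = 1 := by simpa using hW hx
    simpa [this] using hx
  have hscale : ∀ W : Set (EuclideanSpace ℝ (Fin (n + 1))), ∀ x ∈ {x | ‖x‖⁻¹ • x ∈ W},
      ∀ r : ℝ, 0 < r → r • x ∈ {x | ‖x‖⁻¹ • x ∈ W} := by
    intro W x hx r hr
    have : (‖r • x‖⁻¹ • r • x) = ‖x‖⁻¹ • x := by
      rw [norm_smul, Real.norm_of_nonneg hr.le, smul_smul, mul_inv, mul_right_comm,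
        inv_mul_cancel₀ hr.ne', one_mul]
    simpa only [Set.mem_ofPred_eq, this] using hx
  obtain ⟨f, hf₂, hf₁⟩ := exists_dual_neg_pos_of_cones
    (convex_setOf_normalize_mem hW₂sub hW₂conv.2) (isOpen_setOf_normalize_mem hW₂sub hW₂op)
    (convex_setOf_normalize_mem hW₁sub hW₁conv.2) (isOpen_setOf_normalize_mem hW₁sub hW₁op)
    (hW₂ne.mono (hunit hW₂sub)) (hW₁ne.mono (hunit hW₁sub)) (hscale W₂) (hscale W₁)
    (Set.disjoint_left.2 fun x h₂ h₁ => (hdisj ▸ ⟨h₁, h₂⟩ : ‖x‖⁻¹ • x ∈ (∅ : Set _)))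
  set v := (InnerProductSpace.toDual ℝ (EuclideanSpace ℝ (Fin (n + 1)))).symm f
  have hv : ∀ x, ⟪v, x⟫ = f x := fun x => InnerProductSpace.toDual_symm_apply
  have hv0 : v ≠ 0 := by
    intro h
    obtain ⟨Q, hQ⟩ := hW₁ne
    have := hf₁ Q (hunit hW₁sub Q hQ)
    rw [← hv, h, inner_zero_left] at this
    exact this.false
  have hpos : 0 < ‖v‖⁻¹ := inv_pos.2 (norm_pos_iff.2 hv0)
  refine ⟨‖v‖⁻¹ • v, by simp [norm_smul, hv0], fun Q hQ => ?_, fun R hR => ?_⟩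
  · rw [real_inner_smul_left, hv]
    exact mul_pos hpos (hf₁ Q (hunit hW₁sub Q hQ))
  · rw [real_inner_smul_left, hv]
    exact mul_neg_of_pos_of_neg hpos (hf₂ R (hunit hW₂sub R hR))
end
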